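/- Let x^1, …, x^n be n pairwise distinct points in ℝ^d, let Φ ∈ ℝ^{n×n} be the matrix with entries Φ_{ij} = ‖x^i − x^j‖₂³, and let P ∈ ℝ^{n×(d+1)} be the matrix whose i-th row is ((x^i)ᵀ, 1). Then the symmetric block matrix A = [[Φ, P], [Pᵀ, 0]] ∈ ℝ^{(n+d+1)×(n+d+1)} is invertible if and only if rank(P) = d + 1. -/

import Mathlib

open Matrix

open MeasureTheory Set Filter Topology

/-- The second-order Taylor remainder of `exp (-u)` at `0` is at most quadratic on `[0, ∞)`. -/
lemma exp_neg_sub_one_add_le_sq {u : ℝ} (hu : 0 ≤ u) : Real.exp (-u) - 1 + u ≤ u ^ 2 := by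
  rcases le_total u 1 with h | h
  · have := Real.abs_exp_sub_one_sub_id_le (x := -u) (by rwa [abs_neg, abs_of_nonneg hu])
    have := (abs_le.1 this).2
    nlinarith
  · have : Real.exp (-u) ≤ 1 := Real.exp_le_one_iff.2 (by linarith)
    nlinarith

lemma integrableOn_exp_neg_sub_one_add_mul_rpow {s : ℝ} (hs : 0 ≤ s) :
    IntegrableOn (fun t : ℝ => (Real.exp (-(s * t)) - 1 + s * t) * t ^ (-(5 / 2) : ℝ))
      (Ioi 0) := by
  have hm : Measurable
      (fun t : ℝ => (Real.exp (-(s * t)) - 1 + s * t) * t ^ (-(5 / 2) : ℝ)) := by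
    fun_prop
  have hnn : ∀ t : ℝ, 0 ≤ Real.exp (-(s * t)) - 1 + s * t := fun t => by
    linarith [Real.add_one_le_exp (-(s * t))]
  rw [← Ioc_union_Ioi_eq_Ioi (zero_le_one' ℝ)]
  refine IntegrableOn.union ?_ ?_
  · have hi : IntegrableOn (fun t : ℝ => s ^ 2 * t ^ (-(1 / 2) : ℝ)) (Ioc 0 1) :=
      ((intervalIntegrable_iff_integrableOn_Ioc_of_le zero_le_one).1
        (intervalIntegral.intervalIntegrable_rpow' (by norm_num))).const_mul _
    refine hi.mono' hm.aestronglyMeasurable ?_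
    filter_upwards [ae_restrict_mem measurableSet_Ioc] with t ht
    have h0 : 0 < t := ht.1
    rw [Real.norm_of_nonneg (mul_nonneg (hnn t) (Real.rpow_nonneg h0.le _))]
    calc _ ≤ (s * t) ^ 2 * t ^ (-(5 / 2) : ℝ) := by
          gcongr
          exact exp_neg_sub_one_add_le_sq (by positivity)
      _ = s ^ 2 * (t ^ (2 : ℝ) * t ^ (-(5 / 2) : ℝ)) := by
          rw [Real.rpow_two]; ring
      _ = _ := by rw [← Real.rpow_add h0]; norm_num
  · have hi : IntegrableOn (fun t : ℝ => s * t ^ (-(3 / 2) : ℝ)) (Ioi 1) :=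
      (integrableOn_Ioi_rpow_of_lt (by norm_num) zero_lt_one).const_mul _
    refine hi.mono' hm.aestronglyMeasurable ?_
    filter_upwards [ae_restrict_mem measurableSet_Ioi] with t ht
    have h0 : 0 < t := zero_lt_one.trans ht
    rw [Real.norm_of_nonneg (mul_nonneg (hnn t) (Real.rpow_nonneg h0.le _))]
    calc _ ≤ (s * t) * t ^ (-(5 / 2) : ℝ) := by
          gcongr
          have : Real.exp (-(s * t)) ≤ 1 := Real.exp_le_one_iff.2 (by
            have : 0 ≤ s * t := by positivity
            linarith)
          linarith
      _ = s * (t ^ (1 : ℝ) * t ^ (-(5 / 2) : ℝ)) := by rw [Real.rpow_one]; ring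
      _ = _ := by rw [← Real.rpow_add h0]; norm_num

/-- `r ^ 3` is, up to a constant factor, a mixture of second-order Taylor remainders of
Gaussians. -/
lemma integral_exp_neg_sub_one_add_mul_rpow {r : ℝ} (hr : 0 ≤ r) :
    ∫ t in Ioi (0 : ℝ), (Real.exp (-(r ^ 2 * t)) - 1 + r ^ 2 * t) * t ^ (-(5 / 2) : ℝ) =
      r ^ 3 * ∫ t in Ioi (0 : ℝ), (Real.exp (-t) - 1 + t) * t ^ (-(5 / 2) : ℝ) := by
  rcases hr.eq_or_lt with rfl | hr
  · simp
  have h := integral_comp_mul_left_Ioi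
    (fun t : ℝ => (Real.exp (-t) - 1 + t) * t ^ (-(5 / 2) : ℝ)) 0 (pow_pos hr 2)
  rw [mul_zero, smul_eq_mul] at h
  have h5 : (r ^ 2) ^ (-(5 / 2) : ℝ) = (r ^ 5)⁻¹ := by
    rw [← Real.rpow_natCast, ← Real.rpow_mul hr.le, ← Real.rpow_natCast r 5,
      ← Real.rpow_neg hr.le]
    norm_num
  calc _ = ∫ t in Ioi (0 : ℝ), r ^ 5 *
        ((Real.exp (-(r ^ 2 * t)) - 1 + r ^ 2 * t) * (r ^ 2 * t) ^ (-(5 / 2) : ℝ)) := by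
        refine setIntegral_congr_fun measurableSet_Ioi fun t ht => ?_
        rw [Real.mul_rpow (by positivity) (le_of_lt ht), h5]
        field_simp
    _ = _ := by
        rw [integral_const_mul, h]
        field_simp

section QuadraticForms

variable {ι κ : Type*} [Fintype ι] [Fintype κ]

lemma sum_mul_inner_pow_nonneg (x : ι → EuclideanSpace ℝ κ) (w : ι → ℝ) (k : ℕ) :
    0 ≤ ∑ i, ∑ j, w i * w j * inner ℝ (x i) (x j) ^ k := by
  classical
  have h : ∑ i, ∑ j, w i * w j * inner ℝ (x i) (x j) ^ k =
      ∑ f : Fin k → κ, (∑ i, w i * ∏ a, x i (f a)) ^ 2 := by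
    simp_rw [sq, Finset.sum_mul_sum]
    rw [Finset.sum_comm]
    simp_rw [Finset.sum_comm (s := (Finset.univ : Finset (Fin k → κ)))]
    rw [Finset.sum_comm]
    refine Finset.sum_congr rfl fun i _ => Finset.sum_congr rfl fun j _ => ?_
    rw [PiLp.inner_apply, Fintype.sum_pow, Finset.mul_sum]
    refine Finset.sum_congr rfl fun f _ => ?_
    simp only [RCLike.inner_apply, conj_trivial, Finset.prod_mul_distrib]
    ring
  rw [h]
  exact Finset.sum_nonneg fun f _ => sq_nonneg _

/-- The Gaussian kernel is positive semidefinite. -/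
lemma sum_mul_exp_neg_norm_sq_nonneg (x : ι → EuclideanSpace ℝ κ) (w : ι → ℝ) {t : ℝ}
    (ht : 0 ≤ t) : 0 ≤ ∑ i, ∑ j, w i * w j * Real.exp (-(‖x i - x j‖ ^ 2 * t)) := by
  let v : ι → ℝ := fun i => w i * Real.exp (-(‖x i‖ ^ 2 * t))
  have hv : ∀ i j, w i * w j * Real.exp (-(‖x i - x j‖ ^ 2 * t)) =
      v i * v j * Real.exp (2 * t * inner ℝ (x i) (x j)) := fun i j => by
    have : -(‖x i - x j‖ ^ 2 * t) =
        -(‖x i‖ ^ 2 * t) + -(‖x j‖ ^ 2 * t) + 2 * t * inner ℝ (x i) (x j) := by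
      rw [norm_sub_sq_real]; ring
    rw [this, Real.exp_add, Real.exp_add]
    ring
  simp_rw [hv]
  have hs : HasSum (fun k : ℕ => ∑ i, ∑ j, v i * v j *
      ((2 * t * inner ℝ (x i) (x j)) ^ k / (k.factorial : ℝ)))
      (∑ i, ∑ j, v i * v j * Real.exp (2 * t * inner ℝ (x i) (x j))) := by
    refine hasSum_sum fun i _ => hasSum_sum fun j _ => HasSum.mul_left _ ?_
    rw [Real.exp_eq_exp_ℝ]
    exact NormedSpace.expSeries_div_hasSum_exp _
  refine hs.nonneg fun k => ?_
  have : ∑ i, ∑ j, v i * v j * ((2 * t * inner ℝ (x i) (x j)) ^ k / (k.factorial : ℝ)) =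
      (2 * t) ^ k / (k.factorial : ℝ) * ∑ i, ∑ j, v i * v j * inner ℝ (x i) (x j) ^ k := by
    simp_rw [Finset.mul_sum, mul_pow]
    refine Finset.sum_congr rfl fun i _ => Finset.sum_congr rfl fun j _ => ?_
    ring
  rw [this]
  exact mul_nonneg (by positivity) (sum_mul_inner_pow_nonneg x v k)

lemma tendsto_sum_mul_exp_neg_norm_sq {x : ι → EuclideanSpace ℝ κ} (hx : Function.Injective x)
    (w : ι → ℝ) :
    Tendsto (fun t : ℝ => ∑ i, ∑ j, w i * w j * Real.exp (-(‖x i - x j‖ ^ 2 * t))) atTop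
      (𝓝 (∑ i, w i ^ 2)) := by
  classical
  have h : ∑ i, w i ^ 2 = ∑ i, ∑ j, w i * w j * (if i = j then (1 : ℝ) else 0) := by
    simp [sq]
  rw [h]
  refine tendsto_finsetSum _ fun i _ => tendsto_finsetSum _ fun j _ =>
    Tendsto.const_mul _ ?_
  split_ifs with hij
  · simp [hij]
  · have : 0 < ‖x i - x j‖ ^ 2 := by
      have := sub_ne_zero.2 (hx.ne hij)
      positivity
    exact Real.tendsto_exp_neg_atTop_nhds_zero.comp (tendsto_id.const_mul_atTop this)

/-- The cubic kernel is strictly positive definite on weights annihilating affine functions. -/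
lemma sum_mul_norm_sub_pow_three_pos {x : ι → EuclideanSpace ℝ κ} (hx : Function.Injective x)
    {w : ι → ℝ} (hw : w ≠ 0) (hw₀ : ∑ i, w i = 0) (hw₁ : ∑ i, w i • x i = 0) :
    0 < ∑ i, ∑ j, w i * w j * ‖x i - x j‖ ^ 3 := by
  have h₀ : ∑ i, ∑ j, w i * w j = 0 := by
    rw [← Finset.sum_mul_sum, hw₀, zero_mul]
  have h₁ : ∑ i, ∑ j, w i * w j * ‖x i - x j‖ ^ 2 = 0 := by
    have e : ∀ i j, w i * w j * ‖x i - x j‖ ^ 2 = w i * ‖x i‖ ^ 2 * w j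
        - 2 * inner ℝ (w i • x i) (w j • x j) + w i * (w j * ‖x j‖ ^ 2) := fun i j => by
      rw [norm_sub_sq_real, real_inner_smul_left, real_inner_smul_right]; ring
    simp_rw [e, Finset.sum_add_distrib, Finset.sum_sub_distrib, ← Finset.mul_sum,
      ← inner_sum, hw₁, hw₀, ← Finset.sum_mul, hw₀]
    simp
  set G : ℝ → ℝ := fun t => ∑ i, ∑ j, w i * w j * Real.exp (-(‖x i - x j‖ ^ 2 * t)) with hG
  set ρ : ℝ → ℝ := fun t => t ^ (-(5 / 2) : ℝ)
  have hGρ : ∀ t, ∑ i, ∑ j, w i * w j *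
      ((Real.exp (-(‖x i - x j‖ ^ 2 * t)) - 1 + ‖x i - x j‖ ^ 2 * t) * ρ t) = G t * ρ t := by
    intro t
    have e : ∀ i j, w i * w j *
        ((Real.exp (-(‖x i - x j‖ ^ 2 * t)) - 1 + ‖x i - x j‖ ^ 2 * t) * ρ t) =
        (w i * w j * Real.exp (-(‖x i - x j‖ ^ 2 * t))) * ρ t - w i * w j * ρ t +
          w i * w j * ‖x i - x j‖ ^ 2 * (t * ρ t) := fun i j => by ring
    simp_rw [e, Finset.sum_add_distrib, Finset.sum_sub_distrib, ← Finset.sum_mul, h₀, h₁]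
    simp [hG]
  have hint : ∀ i j, IntegrableOn (fun t => w i * w j *
      ((Real.exp (-(‖x i - x j‖ ^ 2 * t)) - 1 + ‖x i - x j‖ ^ 2 * t) * ρ t)) (Ioi 0) :=
    fun i j => (integrableOn_exp_neg_sub_one_add_mul_rpow (sq_nonneg _)).const_mul _
  have hGi : IntegrableOn (fun t => G t * ρ t) (Ioi 0) := by
    simp_rw [← hGρ]
    exact integrable_finsetSum _ fun i _ => integrable_finsetSum _ fun j _ => hint i j
  have hpos : 0 < ∫ t in Ioi (0 : ℝ), G t * ρ t := by
    rw [setIntegral_pos_iff_support_of_nonneg_ae _ hGi]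
    · have hsq : 0 < ∑ i, w i ^ 2 := by
        obtain ⟨i, hi⟩ := Function.ne_iff.1 hw
        exact Finset.sum_pos' (fun i _ => sq_nonneg _)
          ⟨i, Finset.mem_univ _, by have : w i ≠ 0 := hi; positivity⟩
      obtain ⟨T, hT⟩ := eventually_atTop.1
        (((tendsto_sum_mul_exp_neg_norm_sq hx w).eventually_const_lt hsq).and
          (eventually_gt_atTop 0))
      refine lt_of_lt_of_le ?_ (measure_mono (s := Ioi T) fun t ht => ?_)
      · simp
      · obtain ⟨hGt, h0⟩ := hT t (le_of_lt ht)
        exact ⟨(mul_pos hGt (Real.rpow_pos_of_pos h0 _)).ne', h0⟩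
    · filter_upwards [ae_restrict_mem measurableSet_Ioi] with t ht
      exact mul_nonneg (sum_mul_exp_neg_norm_sq_nonneg x w (le_of_lt ht))
        (Real.rpow_nonneg (le_of_lt ht) _)
  have hval : ∫ t in Ioi (0 : ℝ), G t * ρ t = (∑ i, ∑ j, w i * w j * ‖x i - x j‖ ^ 3) *
      ∫ t in Ioi (0 : ℝ), (Real.exp (-t) - 1 + t) * ρ t := by
    simp_rw [← hGρ]
    rw [integral_finsetSum _ fun i _ => integrable_finsetSum _ fun j _ => hint i j,
      Finset.sum_mul]
    refine Finset.sum_congr rfl fun i _ => ?_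
    rw [integral_finsetSum _ fun j _ => hint i j, Finset.sum_mul]
    refine Finset.sum_congr rfl fun j _ => ?_
    rw [integral_const_mul, integral_exp_neg_sub_one_add_mul_rpow (norm_nonneg _)]
    exact (mul_assoc _ _ _).symm
  rw [hval] at hpos
  refine pos_of_mul_pos_left hpos (setIntegral_nonneg measurableSet_Ioi fun t ht => ?_)
  exact mul_nonneg (by linarith [Real.add_one_le_exp (-t)]) (Real.rpow_nonneg (le_of_lt ht) _)

end QuadraticForms

lemma Matrix.rank_eq_card_width_iff_mulVec_injective {K m n : Type*} [Field K] [Fintype m]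
    [Fintype n] (A : Matrix m n K) :
    A.rank = Fintype.card n ↔ Function.Injective A.mulVec := by
  have h := A.mulVecLin.finrank_range_add_finrank_ker
  rw [Module.finrank_fintype_fun_eq_card] at h
  change _ ↔ Function.Injective A.mulVecLin
  rw [← LinearMap.ker_eq_bot, ← Submodule.finrank_eq_zero, Matrix.rank]
  omega

/-- **Cubic RBF system invertibility.**
Let `x 1, …, x n` be `n` pairwise distinct points in `ℝ^d`, let `Φ` be the `n × n`
matrix with entries `Φ i j = ‖x i − x j‖₂³`, and let `P` be the `n × (d+1)` matrix
whose `i`-th row is `((x i)ᵀ, 1)`.  Then the symmetric block matrix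
`A = [[Φ, P], [Pᵀ, 0]]` is invertible if and only if `rank P = d + 1`. -/
theorem cubic_rbf_block_matrix_invertible_iff_rank
    (d n : ℕ) (x : Fin n → EuclideanSpace ℝ (Fin d))
    (hx : Function.Injective x)
    (Φ : Matrix (Fin n) (Fin n) ℝ)
    (hΦ : ∀ i j, Φ i j = ‖x i - x j‖ ^ 3)
    (P : Matrix (Fin n) (Fin (d + 1)) ℝ)
    (hP₁ : ∀ i (j : Fin d), P i (Fin.castSucc j) = x i j)
    (hP₂ : ∀ i, P i (Fin.last d) = 1) :
    IsUnit (Matrix.fromBlocks Φ P Pᵀ (0 : Matrix (Fin (d + 1)) (Fin (d + 1)) ℝ)) ↔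
      P.rank = d + 1 := by
  rw [← Matrix.mulVec_injective_iff_isUnit]
  have hrank := P.rank_eq_card_width_iff_mulVec_injective
  rw [Fintype.card_fin] at hrank
  rw [hrank]
  constructor
  · intro h a b hab
    have := @h (Sum.elim 0 a) (Sum.elim 0 b) (by simp [Matrix.fromBlocks_mulVec, hab])
    exact funext fun i => congrFun this (Sum.inr i)
  · intro h
    change Function.Injective (Matrix.mulVecLin _)
    rw [injective_iff_map_eq_zero]
    intro v hv
    obtain ⟨w, c, rfl⟩ : ∃ w c, v = Sum.elim w c :=
      ⟨v ∘ Sum.inl, v ∘ Sum.inr, (Sum.elim_comp_inl_inr v).symm⟩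
    rw [Matrix.mulVecLin_apply, Matrix.fromBlocks_mulVec] at hv
    have h₁ : Φ *ᵥ w + P *ᵥ c = 0 := funext fun i => by simpa using congrFun hv (Sum.inl i)
    have h₂ : Pᵀ *ᵥ w = 0 := funext fun i => by simpa using congrFun hv (Sum.inr i)
    have hquad : w ⬝ᵥ Φ *ᵥ w = 0 := by
      have : w ⬝ᵥ (Φ *ᵥ w + P *ᵥ c) = 0 := by rw [h₁, dotProduct_zero]
      rwa [dotProduct_add, dotProduct_mulVec w P, ← mulVec_transpose, h₂, zero_dotProduct,
        add_zero] at this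
    have hw : w = 0 := by
      by_contra hw
      have hpos := sum_mul_norm_sub_pow_three_pos hx hw
        (by simpa [mulVec, dotProduct, hP₂] using congrFun h₂ (Fin.last d))
        (by
          ext j
          simpa [mulVec, dotProduct, hP₁, mul_comm] using congrFun h₂ j.castSucc)
      refine hpos.ne' (Eq.trans ?_ hquad)
      simp_rw [dotProduct, mulVec, dotProduct, Finset.mul_sum, hΦ]
      refine Finset.sum_congr rfl fun i _ => Finset.sum_congr rfl fun j _ => ?_
      ring
    subst hw
    have hc : c = 0 := h (by simpa using h₁)
    subst hc
    simp
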